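/- Let R = ℂ[x,y,z,w], let J = (x·z − y², x·w − y·z, y·w − z²) be the homogeneous ideal of the standard twisted cubic curve C ⊂ P³, let ℓ be a linear form and q a quadratic form such that ℓ, q is a regular sequence, let I = (ℓ, q) (the homogeneous ideal of a conic Q), and suppose that (x,y,z,w)^N ⊆ I + J for some natural number N (i.e., Q ∩ C = ∅). Then the ideal I ∩ J is strictly larger than the ideal generated by its homogeneous elements of degree at most 3. (This expresses that the twisted ideal sheaf I_Y(3) of Y = Q ∪ C is not globally generated.) -/

import Mathlib

open MvPolynomial

/-- The parametrization `x ↦ s³, y ↦ s²t, z ↦ st², w ↦ t³` of the twisted cubic. -/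
noncomputable def twistedCubicParam : MvPolynomial (Fin 4) ℂ →ₐ[ℂ] MvPolynomial (Fin 2) ℂ :=
  aeval ![X 0 ^ 3, X 0 ^ 2 * X 1, X 0 * X 1 ^ 2, X 1 ^ 3]

theorem exists_coeffs_of_isHomogeneous_one {l : MvPolynomial (Fin 4) ℂ} (hl : l.IsHomogeneous 1) :
    ∃ c : Fin 4 → ℂ, l = C (c 0) * X 0 + C (c 1) * X 1 + C (c 2) * X 2 + C (c 3) * X 3 := by
  rw [← mem_homogeneousSubmodule, homogeneousSubmodule_one_eq_span_X,
    Submodule.mem_span_range_iff_exists_fun] at hl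
  obtain ⟨c, hc⟩ := hl
  exact ⟨c, by simp [← hc, Fin.sum_univ_four, smul_eq_C_mul]⟩

theorem twistedCubicParam_isHomogeneous {f : MvPolynomial (Fin 4) ℂ} {n : ℕ}
    (hf : f.IsHomogeneous n) : (twistedCubicParam f).IsHomogeneous (3 * n) := by
  refine hf.aeval _ fun i => ?_
  fin_cases i
  · exact (isHomogeneous_X ℂ (0 : Fin 2)).pow 3
  · exact ((isHomogeneous_X ℂ (0 : Fin 2)).pow 2).mul (isHomogeneous_X ℂ 1)
  · exact (isHomogeneous_X ℂ (0 : Fin 2)).mul ((isHomogeneous_X ℂ 1).pow 2)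
  · exact (isHomogeneous_X ℂ (1 : Fin 2)).pow 3

/-- The twisted cubic spans `ℙ³`. -/
theorem eq_zero_of_twistedCubicParam_eq_zero {l : MvPolynomial (Fin 4) ℂ}
    (hl : l.IsHomogeneous 1) (h : twistedCubicParam l = 0) : l = 0 := by
  obtain ⟨c, rfl⟩ := exists_coeffs_of_isHomogeneous_one hl
  have key (s t : ℂ) :
      c 0 * s ^ 3 + c 1 * (s ^ 2 * t) + c 2 * (s * t ^ 2) + c 3 * t ^ 3 = 0 := by
    simpa [twistedCubicParam] using congrArg (eval ![s, t]) h
  have h0 : c 0 = 0 := by simpa using key 1 0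
  have h3 : c 3 = 0 := by simpa using key 0 1
  have hsum := key 1 1
  have hdiff := key 1 (-1)
  have h1 : c 1 = 0 := by linear_combination (hsum - hdiff) / 2 - h3
  have h2 : c 2 = 0 := by linear_combination (hsum + hdiff) / 2 - h0
  simp [h0, h1, h2, h3]

theorem dvd_of_twistedCubicParam_dvd {l b : MvPolynomial (Fin 4) ℂ} {e : ℕ}
    (hl : l.IsHomogeneous 1) (hl0 : l ≠ 0) (hb : b.IsHomogeneous e) (he : e ≤ 1)
    (h : twistedCubicParam l ∣ twistedCubicParam b) : l ∣ b := by
  have hφl : twistedCubicParam l ≠ 0 := fun h0 => hl0 (eq_zero_of_twistedCubicParam_eq_zero hl h0)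
  have hdeg := (twistedCubicParam_isHomogeneous hl).totalDegree hφl
  have hbdeg := (twistedCubicParam_isHomogeneous hb).totalDegree_le
  obtain ⟨k, hk⟩ := h
  rcases eq_or_ne k 0 with rfl | hk0
  · rw [mul_zero] at hk
    interval_cases e
    · rw [← totalDegree_zero_iff_isHomogeneous, totalDegree_eq_zero_iff_eq_C] at hb
      rw [hb, twistedCubicParam, algHom_C, algebraMap_eq, C_eq_zero] at hk
      rw [hb, hk, C_0]
      exact dvd_zero l
    · rw [eq_zero_of_twistedCubicParam_eq_zero hb hk]
      exact dvd_zero l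
  · rw [hk, totalDegree_mul_of_isDomain hφl hk0] at hbdeg
    obtain rfl : e = 1 := by omega
    obtain ⟨c, rfl⟩ : ∃ c, k = C c :=
      ⟨_, totalDegree_eq_zero_iff_eq_C.mp (by omega)⟩
    have hsub : (b - l * C c).IsHomogeneous 1 := hb.sub (hl.mul (isHomogeneous_C _ c))
    refine ⟨C c, sub_eq_zero.mp (eq_zero_of_twistedCubicParam_eq_zero hsub ?_)⟩
    rw [map_sub, map_mul, hk, twistedCubicParam, algHom_C, algebraMap_eq, sub_self]

theorem isRelPrime_X_pow (m n : ℕ) :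
    IsRelPrime (X 0 ^ m : MvPolynomial (Fin 2) ℂ) (X 1 ^ n) := by
  refine IsRelPrime.pow ((X_prime (i := (0 : Fin 2))).irreducible.isRelPrime_iff_not_dvd.mpr ?_)
  rintro ⟨k, hk⟩
  simpa using congrArg (eval ![(0 : ℂ), 1]) hk

theorem exists_eq_mul_add_mul_of_mem_span_pair {l q f : MvPolynomial (Fin 4) ℂ} {m n d : ℕ}
    (hl : l.IsHomogeneous m) (hq : q.IsHomogeneous n) (hf : f.IsHomogeneous d)
    (hmem : f ∈ Ideal.span {l, q}) :
    ∃ a b, b.IsHomogeneous (d - n) ∧ f = a * l + b * q := by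
  obtain ⟨a, b, hab⟩ := Ideal.mem_span_pair.mp hmem
  have hcomp : f = homogeneousComponent d (a * l) + homogeneousComponent d (b * q) := by
    rw [← map_add, hab, homogeneousComponent_of_mem hf, if_pos rfl]
  let _ : GradedAlgebra (homogeneousSubmodule (Fin 4) ℂ) := gradedAlgebra
  have hdec (g : MvPolynomial (Fin 4) ℂ) (i : ℕ) : homogeneousComponent i g =
      (DirectSum.decompose (homogeneousSubmodule (Fin 4) ℂ) g i : MvPolynomial (Fin 4) ℂ) :=
    (decomposition.decompose'_apply g i).symm
  have hmul {g p : MvPolynomial (Fin 4) ℂ} {k : ℕ} (hp : p.IsHomogeneous k) :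
      ∃ g', g'.IsHomogeneous (d - k) ∧ homogeneousComponent d (g * p) = g' * p := by
    by_cases hk : k ≤ d
    · refine ⟨_, homogeneousComponent_isHomogeneous (d - k) g, ?_⟩
      rw [hdec, hdec, DirectSum.coe_decompose_mul_of_right_mem_of_le _ hp hk]
    · refine ⟨0, isHomogeneous_zero _ _ _, ?_⟩
      rw [hdec, DirectSum.coe_decompose_mul_of_right_mem_of_not_le _ hp hk, zero_mul]
  obtain ⟨a', -, ha'⟩ := hmul (g := a) hl
  obtain ⟨b', hb', hbq⟩ := hmul (g := b) hq
  exact ⟨a', b', hb', by rw [hcomp, ha', hbq]⟩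

theorem dvd_of_dvd_mul_of_isRegular {l q g : MvPolynomial (Fin 4) ℂ}
    (hreg : RingTheory.Sequence.IsRegular (MvPolynomial (Fin 4) ℂ) [l, q]) (h : l ∣ q * g) :
    l ∣ g := by
  have hq := hreg.regular_mod_prev 1 (by simp)
  have := mem_of_isSMulRegular_quotient_of_smul_mem hq (x := g)
  simpa [Ideal.mem_span_singleton, h] using this

theorem ne_zero_of_isRegular {l q : MvPolynomial (Fin 4) ℂ}
    (hreg : RingTheory.Sequence.IsRegular (MvPolynomial (Fin 4) ℂ) [l, q]) : l ≠ 0 := by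
  rintro rfl
  exact IsSMulRegular.not_zero ((RingTheory.Sequence.isRegular_cons_iff _ _ _).mp hreg).1

/-- No plane is contained in the twisted cubic. -/
theorem not_forall_dvd_twistedCubic {l : MvPolynomial (Fin 4) ℂ} (hl : l.IsHomogeneous 1) :
    ¬ (l ∣ X 0 * X 2 - X 1 ^ 2 ∧ l ∣ X 0 * X 3 - X 1 * X 2 ∧ l ∣ X 1 * X 3 - X 2 ^ 2) := by
  obtain ⟨c, rfl⟩ := exists_coeffs_of_isHomogeneous_one hl
  rintro ⟨⟨f, hf⟩, ⟨g, hg⟩, ⟨h, hh⟩⟩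
  have h0 : c 0 = 0 := by
    have := congrArg (eval ![c 1, -c 0, 0, 0]) hf
    simp at this
    grind
  have h3 : c 3 = 0 := by
    have := congrArg (eval ![0, 0, c 3, -c 2]) hh
    simp at this
    grind
  simpa [h0, h3] using congrArg (eval ![(1 : ℂ), 0, 0, 1]) hg

theorem isRelPrime_twistedCubicParam {l q : MvPolynomial (Fin 4) ℂ} {I J : Ideal _}
    (hI : I = Ideal.span {l, q}) (hJ : ∀ f ∈ J, twistedCubicParam f = 0)
    (hdisj : ∃ N : ℕ,
      (Ideal.span ({X 0, X 1, X 2, X 3} : Set (MvPolynomial (Fin 4) ℂ))) ^ N ≤ I + J) :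
    IsRelPrime (twistedCubicParam l) (twistedCubicParam q) := by
  obtain ⟨N, hN⟩ := hdisj
  intro p hpl hpq
  have key {f : MvPolynomial (Fin 4) ℂ} (hf : f ∈ ({X 0, X 1, X 2, X 3} : Set _)) :
      p ∣ twistedCubicParam f ^ N := by
    obtain ⟨i, hi, j, hj, hij⟩ :=
      Submodule.mem_sup.mp (hN (Ideal.pow_mem_pow (Ideal.subset_span hf) N))
    obtain ⟨a, b, rfl⟩ := Ideal.mem_span_pair.mp (hI ▸ hi)
    rw [← map_pow, ← hij, map_add, hJ j hj, add_zero, map_add, map_mul, map_mul]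
    exact dvd_add (hpl.mul_left _) (hpq.mul_left _)
  have hs := key (f := X 0) (by simp)
  have ht := key (f := X 3) (by simp)
  simp only [twistedCubicParam, aeval_X, ← pow_mul, Matrix.cons_val] at hs ht
  exact isRelPrime_X_pow _ _ hs ht

theorem twistedCubicParam_eq_zero_of_mem {f : MvPolynomial (Fin 4) ℂ}
    (hf : f ∈ Ideal.span
      {X 0 * X 2 - X 1 ^ 2, X 0 * X 3 - X 1 * X 2, X 1 * X 3 - X 2 ^ 2}) :
    twistedCubicParam f = 0 := by
  rw [← RingHom.mem_ker]
  refine (Ideal.span_le.mpr ?_) hf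
  rintro g (rfl | rfl | rfl) <;>
  · simp only [SetLike.mem_coe, RingHom.mem_ker, twistedCubicParam, map_sub, map_mul, map_pow,
      aeval_X, Matrix.cons_val]
    ring

/-- Variables: `x = X 0`, `y = X 1`, `z = X 2`, `w = X 3` in `R = ℂ[x,y,z,w]`.
If `C` is the standard twisted cubic, with ideal `J`, and `Q` is a conic, with ideal
`I = (ℓ, q)` (`ℓ, q` a regular sequence), disjoint from `C`, then the ideal
`I ∩ J` of `Y = Q ∪ C` is strictly larger than the ideal generated by its
homogeneous elements of degree at most `3` (i.e. `I_Y(3)` is not globally generated). -/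
theorem conic_union_twisted_cubic_not_generated_by_cubics
    (l q : MvPolynomial (Fin 4) ℂ)
    (hl : l.IsHomogeneous 1) (hq : q.IsHomogeneous 2)
    (hreg : RingTheory.Sequence.IsRegular (MvPolynomial (Fin 4) ℂ) [l, q])
    (J : Ideal (MvPolynomial (Fin 4) ℂ))
    (hJ : J = Ideal.span {X 0 * X 2 - X 1 ^ 2, X 0 * X 3 - X 1 * X 2, X 1 * X 3 - X 2 ^ 2})
    (I : Ideal (MvPolynomial (Fin 4) ℂ))
    (hI : I = Ideal.span {l, q})
    (hdisj : ∃ N : ℕ,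
      (Ideal.span ({X 0, X 1, X 2, X 3} : Set (MvPolynomial (Fin 4) ℂ))) ^ N ≤ I + J) :
    Ideal.span {f | f ∈ I ⊓ J ∧ ∃ d ≤ 3, f.IsHomogeneous d} < I ⊓ J := by
  have hJ0 : ∀ f ∈ J, twistedCubicParam f = 0 := fun f hf =>
    twistedCubicParam_eq_zero_of_mem (hJ ▸ hf)
  have hlt : Ideal.span {f | f ∈ I ⊓ J ∧ ∃ d ≤ 3, f.IsHomogeneous d} ≤ Ideal.span {l} := by
    refine Ideal.span_le.mpr ?_
    rintro f ⟨⟨hfI, hfJ⟩, d, hd, hf⟩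
    obtain ⟨a, b, hb, rfl⟩ := exists_eq_mul_add_mul_of_mem_span_pair hl hq hf (hI ▸ hfI)
    have hzero := hJ0 _ hfJ
    rw [map_add, map_mul, map_mul] at hzero
    have hdvd : twistedCubicParam l ∣ twistedCubicParam b * twistedCubicParam q :=
      ⟨-twistedCubicParam a, by linear_combination hzero⟩
    have hlb := dvd_of_twistedCubicParam_dvd hl (ne_zero_of_isRegular hreg) hb (by omega)
      ((isRelPrime_twistedCubicParam hI hJ0 hdisj).dvd_of_dvd_mul_right hdvd)
    exact Ideal.mem_span_singleton.mpr (dvd_add (dvd_mul_left l a) (hlb.mul_right q))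
  refine lt_of_le_of_ne (Ideal.span_le.mpr fun f hf => hf.1) fun heq => ?_
  have hdvd : ∀ g ∈ J, l ∣ g := fun g hg => by
    refine dvd_of_dvd_mul_of_isRegular hreg (Ideal.mem_span_singleton.mp (hlt ?_))
    rw [heq]
    refine ⟨?_, J.mul_mem_left q hg⟩
    exact hI ▸ Ideal.mul_mem_right g _ (Ideal.subset_span (by simp))
  subst hJ
  exact not_forall_dvd_twistedCubic hl ⟨hdvd _ (Ideal.subset_span (by simp)),
    hdvd _ (Ideal.subset_span (by simp)), hdvd _ (Ideal.subset_span (by simp))⟩
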